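/- arXiv:1004.3947 — 3 statements merged into one kernel-verified Lean document; each statement's English description precedes it below -/
import Mathlib

section
/- Let p : E → X be a covering map between topological spaces, where E is nonempty and path-connected and X is path-connected. If for some basepoint e ∈ E the induced homomorphism p_* : π₁(E, e) → π₁(X, p(e)) on fundamental groups is surjective, then p is a homeomorphism (it is bijective, and hence, being a continuous open bijection, a homeomorphism). -/
open CategoryTheory

universe u

/-- The homomorphism induced on fundamental groups by a continuous map. -/
noncomputable def FundamentalGroup.inducedMap {X Y : Type u} [TopologicalSpace X] [TopologicalSpace Y]
    (f : C(X, Y)) (x : X) :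
    FundamentalGroup X x →* FundamentalGroup Y (f x) :=
  Functor.mapEnd (FundamentalGroupoid.fromTop x)
    (FundamentalGroupoid.fundamentalGroupoidFunctor.map (X := TopCat.of X) (Y := TopCat.of Y)
      (TopCat.ofHom f))

/-- Mathlib's former `IsEvenlyCovered` (December 2024). -/
def OldIsEvenlyCovered {E X : Type*} [TopologicalSpace E] [TopologicalSpace X] (f : E → X)
    (x : X) (I : Type*) [TopologicalSpace I] : Prop :=
  DiscreteTopology I ∧ ∃ t : Bundle.Trivialization I f, x ∈ t.baseSet

/-- Mathlib's former `IsCoveringMap` (December 2024). -/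
def OldIsCoveringMap {E X : Type*} [TopologicalSpace E] [TopologicalSpace X] (f : E → X) : Prop :=
  ∀ x, OldIsEvenlyCovered f x (f ⁻¹' {x})

theorem OldIsCoveringMap.isCoveringMap {E X : Type*} [TopologicalSpace E] [TopologicalSpace X]
    {f : E → X} (hf : OldIsCoveringMap f) : IsCoveringMap f := fun x ↦ by
  obtain ⟨_, t, hx⟩ := hf x
  exact .of_trivialization hx

/-- If a covering map from a path-connected space is surjective on fundamental groups at `e`, then
its fiber through `e` is a single point. -/
theorem IsCoveringMap.eq_of_surjective_inducedMap {E X : Type u} [TopologicalSpace E]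
    [TopologicalSpace X] [PathConnectedSpace E] {p : C(E, X)} (hp : IsCoveringMap p) {e : E}
    (hsurj : Function.Surjective (FundamentalGroup.inducedMap p e)) {b : E} (hb : p b = p e) :
    b = e := by
  let β : Path.Homotopic.Quotient e b := .mk (PathConnectedSpace.somePath e b)
  let ℓ : Path.Homotopic.Quotient (p e) (p e) := (β.map p).cast rfl hb.symm
  obtain ⟨γ, hγ⟩ := hsurj ℓ
  have hb' : hp.monodromy ℓ ⟨e, rfl⟩ = ⟨b, hb⟩ :=
    hp.monodromy_eq_of_map_eq (ex := ⟨e, rfl⟩) (ey := ⟨b, hb⟩) β rfl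
  have he : hp.monodromy ℓ ⟨e, rfl⟩ = ⟨e, rfl⟩ := by
    rw [← hγ]
    exact hp.monodromy_map (x := e) (y := e) γ
  exact congrArg Subtype.val (hb'.symm.trans he)

/-- If `p : E → X` is a covering map between path-connected spaces (`E` nonempty) and the
induced homomorphism on fundamental groups at some basepoint `e` is surjective, then `p` is a
homeomorphism. -/
theorem covering_isHomeomorph_of_surjective_pi1_map
    {E X : Type u} [TopologicalSpace E] [TopologicalSpace X]
    [Nonempty E] [PathConnectedSpace E] [PathConnectedSpace X]
    (p : C(E, X)) (hp : OldIsCoveringMap p) (e : E)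
    (hsurj : Function.Surjective (FundamentalGroup.inducedMap p e)) :
    IsHomeomorph p := by
  have cov : IsCoveringMap p := hp.isCoveringMap
  have mono (x : X) : Function.Bijective
      (cov.monodromy (.mk (PathConnectedSpace.somePath (p e) x))) := cov.monodromy_bijective _
  refine ⟨p.continuous, cov.isOpenMap, fun a b hab ↦ ?_, fun x ↦ ?_⟩
  · obtain ⟨⟨a', ha'⟩, ha⟩ := (mono (p b)).surjective ⟨a, hab⟩
    obtain ⟨⟨b', hb'⟩, hb⟩ := (mono (p b)).surjective ⟨b, rfl⟩
    obtain rfl := cov.eq_of_surjective_inducedMap hsurj ha'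
    obtain rfl := cov.eq_of_surjective_inducedMap hsurj hb'
    exact congrArg Subtype.val (ha.symm.trans hb)
  · obtain ⟨a, ha⟩ := cov.monodromy (.mk (PathConnectedSpace.somePath (p e) x)) ⟨e, rfl⟩
    exact ⟨a, ha⟩
end

section
/- Let p : E → X be a covering map with E and X path-connected, let e ∈ E and x = p(e). Then the fiber p⁻¹(x) is in bijection with the set of cosets of the image subgroup p_*(π₁(E, e)) in π₁(X, x); in particular, the cardinality of the fiber (the number of sheets of the covering) equals the index of p_*(π₁(E, e)) in π₁(X, x). -/
open CategoryTheory

universe u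

namespace IsCoveringMap

variable {E X : Type u} [TopologicalSpace E] [TopologicalSpace X] {p : C(E, X)}

/-- The stabilizer of a point under the monodromy action is the image of the fundamental group
of the total space. -/
theorem monodromy_eq_self_iff_mem_range_inducedMap (hp : IsCoveringMap p) (e : E)
    (γ : FundamentalGroup X (p e)) :
    hp.monodromy γ ⟨e, rfl⟩ = ⟨e, rfl⟩ ↔ γ ∈ (FundamentalGroup.inducedMap p e).range := by
  constructor
  · intro h
    have key : ∀ y : p ⁻¹' {p e}, y = ⟨e, rfl⟩ → ∀ Γ : Path.Homotopic.Quotient e y.1,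
        Γ.map p = Path.Homotopic.Quotient.cast γ rfl y.2 →
        ∃ Γ : Path.Homotopic.Quotient e e, Γ.map p = γ := by
      rintro _ rfl Γ hΓ
      exact ⟨Γ, hΓ.trans (Path.Homotopic.Quotient.cast_rfl_rfl γ)⟩
    obtain ⟨Γ, hΓ⟩ := key _ h (hp.liftPathQuotient γ ⟨e, rfl⟩)
      (hp.map_liftPathQuotient γ ⟨e, rfl⟩)
    exact ⟨Γ, hΓ⟩
  · rintro ⟨Γ, rfl⟩
    exact hp.monodromy_map (x := e) (y := e) Γ

/-- The monodromy action on a fiber of a covering map with path-connected total space is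
transitive. -/
theorem exists_monodromy_eq [PathConnectedSpace E] (hp : IsCoveringMap p) {x y : X}
    (e : p ⁻¹' {x}) (e' : p ⁻¹' {y}) :
    ∃ γ : Path.Homotopic.Quotient x y, hp.monodromy γ e = e' := by
  obtain ⟨e, rfl⟩ := e
  obtain ⟨e', rfl⟩ := e'
  exact ⟨_, hp.monodromy_map (.mk (PathConnectedSpace.somePath e e'))⟩

end IsCoveringMap

/-- For a covering map `p : E → X` with `E`, `X` path-connected and `e ∈ E`, the fiber over
`p e` is in bijection with the set of cosets of the image of `p_* : π₁(E,e) → π₁(X,p e)`;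
in particular the cardinality of the fiber equals the index of the image subgroup. -/
theorem covering_fiber_equiv_cosets
    {E X : Type u} [TopologicalSpace E] [TopologicalSpace X]
    [PathConnectedSpace E] [PathConnectedSpace X]
    (p : C(E, X)) (hp : IsCoveringMap p) (e : E) :
    Nonempty ((p ⁻¹' {p e} : Set E) ≃
        (FundamentalGroup X (p e) ⧸ (FundamentalGroup.inducedMap p e).range)) ∧
      Nat.card (p ⁻¹' {p e} : Set E) = (FundamentalGroup.inducedMap p e).range.index := by
  let := hp.fundamentalGroupMulAction (p e)
  let e₀ : p ⁻¹' {p e} := ⟨e, rfl⟩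
  have : MulAction.IsPretransitive (FundamentalGroup X (p e)) (p ⁻¹' {p e}) :=
    ⟨hp.exists_monodromy_eq⟩
  have hstab : MulAction.stabilizer (FundamentalGroup X (p e)) e₀ =
      (FundamentalGroup.inducedMap p e).range :=
    Subgroup.ext (hp.monodromy_eq_self_iff_mem_range_inducedMap e)
  rw [← hstab]
  exact ⟨⟨(Equiv.Set.univ _).symm.trans <| (Equiv.setCongr (MulAction.orbit_eq_univ _ e₀).symm).trans <|
      MulAction.orbitEquivQuotientStabilizer _ e₀⟩,
    (MulAction.index_stabilizer_of_transitive _ e₀).symm⟩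
end

section
/- Let p : E → X be a covering map, where E is nonempty and path-connected, X is path-connected, and the fundamental group π₁(X, p(e)) is nilpotent (for some basepoint e ∈ E). Suppose that for every abelian group G the precomposition map Hom(π₁(X, p(e)), G) → Hom(π₁(E, e), G), sending φ to φ ∘ p_*, is injective. Then p is a homeomorphism. -/
open CategoryTheory

universe u

/-- A subgroup of a nilpotent group that generates it modulo the commutator subgroup is the whole
group. -/
theorem Subgroup.eq_top_of_sup_commutator_eq_top {G : Type*} [Group G] [Group.IsNilpotent G]
    {H : Subgroup G} (h : H ⊔ _root_.commutator G = ⊤) : H = ⊤ := by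
  have descent (n : ℕ) (hn : H ⊔ upperCentralSeries G (n + 1) = ⊤) :
      H ⊔ upperCentralSeries G n = ⊤ := by
    set K := H ⊔ upperCentralSeries G n
    have comm_mem {z : G} (hz : z ∈ upperCentralSeries G (n + 1)) (g : G) :
        z * g * z⁻¹ * g⁻¹ ∈ K :=
      le_sup_right (a := H) (mem_upperCentralSeries_succ_iff.mp hz g)
    have hK : K.Normal := by
      rw [← Subgroup.normalizer_eq_top_iff, eq_top_iff, ← hn, sup_le_iff]
      refine ⟨le_sup_left.trans Subgroup.le_normalizer, fun z hz ↦ ?_⟩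
      have conj_mem {z : G} (hz : z ∈ upperCentralSeries G (n + 1)) {g : G} (hg : g ∈ K) :
          z * g * z⁻¹ ∈ K := by
        simpa using mul_mem (comm_mem hz g) hg
      refine Subgroup.mem_normalizer_iff.mpr fun g ↦ ⟨conj_mem hz, fun hg ↦ ?_⟩
      simpa [mul_assoc] using conj_mem (inv_mem hz) hg
    have hcomm : _root_.commutator G ≤ K := by
      rw [_root_.commutator_def, Subgroup.commutator_le]
      intro a ha b _
      rw [← hn] at ha
      have key : H ⊔ upperCentralSeries G (n + 1) ≤
          (Subgroup.center (G ⧸ K)).comap (QuotientGroup.mk' K) := by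
        refine sup_le (fun x hx ↦ ?_) fun z hz ↦ ?_
        · have : (QuotientGroup.mk' K) x = 1 :=
            (QuotientGroup.eq_one_iff x).mpr (le_sup_left (a := H) hx)
          rw [Subgroup.mem_comap, this]
          exact one_mem _
        · rw [Subgroup.mem_comap, Subgroup.mem_center_iff]
          intro g
          obtain ⟨g, rfl⟩ := QuotientGroup.mk'_surjective K g
          have : QuotientGroup.mk' K (z * g * z⁻¹ * g⁻¹) = 1 :=
            (QuotientGroup.eq_one_iff _).mpr (comm_mem hz g)
          rw [map_mul, mul_eq_one_iff_eq_inv, ← map_inv, inv_inv, map_mul, map_inv,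
            mul_inv_eq_iff_eq_mul, map_mul] at this
          exact this.symm
      have := Subgroup.mem_center_iff.mp (key ha) (QuotientGroup.mk' K b)
      rw [← QuotientGroup.eq_one_iff]
      exact commutatorElement_eq_one_iff_mul_comm.mpr this.symm
    exact eq_top_iff.mpr (h ▸ sup_le le_sup_left hcomm)
  obtain ⟨n, hn⟩ := Group.IsNilpotent.nilpotent G
  have hall (k : ℕ) : H ⊔ upperCentralSeries G k = ⊤ → H = ⊤ := by
    induction k with
    | zero => simp
    | succ k ih => exact fun hk ↦ ih (descent k hk)
  exact hall n (by simp [hn])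

/-- A homomorphism to a nilpotent group along which precomposition is injective on homomorphisms to
abelian groups is surjective. -/
theorem MonoidHom.surjective_of_injective_precomp_commGroup {A : Type*} {B : Type u}
    [Group A] [Group B] [Group.IsNilpotent B] (f : A →* B)
    (hf : ∀ (G : Type u) [CommGroup G], Function.Injective (fun φ : B →* G => φ.comp f)) :
    Function.Surjective f := by
  rw [← MonoidHom.range_eq_top]
  apply Subgroup.eq_top_of_sup_commutator_eq_top
  set M := f.range.map (Abelianization.of (G := B))
  have hM : (QuotientGroup.mk' M).comp Abelianization.of = 1 := by
    refine hf (Abelianization B ⧸ M) (MonoidHom.ext fun a ↦ ?_)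
    exact (QuotientGroup.eq_one_iff _).mpr ⟨f a, ⟨a, rfl⟩, rfl⟩
  rw [← Abelianization.ker_of, ← Subgroup.comap_map_eq, eq_top_iff]
  exact fun b _ ↦ (QuotientGroup.eq_one_iff (Abelianization.of b)).mp (DFunLike.congr_fun hM b)

/-- A covering map from a nonempty path-connected space to a path-connected space that is surjective
on fundamental groups is a homeomorphism. -/
theorem IsCoveringMap.isHomeomorph_of_surjective_inducedMap
    {E X : Type u} [TopologicalSpace E] [TopologicalSpace X]
    [PathConnectedSpace E] [PathConnectedSpace X] {p : C(E, X)} (hp : IsCoveringMap p) (e : E)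
    (hsurj : Function.Surjective (FundamentalGroup.inducedMap p e)) : IsHomeomorph p := by
  have fiber_eq (e' : p ⁻¹' {p e}) : e' = ⟨e, rfl⟩ := by
    obtain ⟨e', he'⟩ := e'
    let Γ : Path.Homotopic.Quotient e e' := .mk (PathConnectedSpace.somePath e e')
    obtain ⟨δ, hδ⟩ := hsurj ((Γ.map p).cast rfl he'.symm)
    have h₁ : hp.monodromy ((Γ.map p).cast rfl he'.symm) ⟨e, rfl⟩ = ⟨e', he'⟩ :=
      hp.monodromy_eq_of_map_eq (ex := ⟨e, rfl⟩) (ey := ⟨e', he'⟩) Γ (by simp; rfl)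
    rw [← h₁, ← hδ]
    exact hp.monodromy_map (x := e) (y := e) δ
  have monodromy_bijective (x : X) :=
    hp.monodromy_bijective (.mk (PathConnectedSpace.somePath x (p e)))
  have hinj : Function.Injective p := fun a b hab ↦ by
    have := (monodromy_bijective (p b)).1 (a₁ := ⟨a, hab⟩) (a₂ := ⟨b, rfl⟩)
      ((fiber_eq _).trans (fiber_eq _).symm)
    exact congrArg Subtype.val this
  have hpsurj : Function.Surjective p := fun x ↦ by
    obtain ⟨a, -⟩ := (monodromy_bijective x).2 ⟨e, rfl⟩
    exact ⟨a, a.2⟩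
  exact ⟨hp.continuous, hp.isLocalHomeomorph.isOpenMap, hinj, hpsurj⟩

/-- Let `p : E → X` be a covering map with `E` nonempty and path-connected, `X` path-connected
and `π₁(X, p e)` nilpotent.  If for every abelian group `G` precomposition with
`p_* : π₁(E,e) → π₁(X,p e)` is injective on homs into `G`, then `p` is a homeomorphism. -/
theorem covering_isHomeomorph_of_injective_precomp
    {E X : Type u} [TopologicalSpace E] [TopologicalSpace X]
    [Nonempty E] [PathConnectedSpace E] [PathConnectedSpace X]
    (p : C(E, X)) (hp : IsCoveringMap p) (e : E)
    [Group.IsNilpotent (FundamentalGroup X (p e))]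
    (hinj : ∀ (G : Type u) [CommGroup G],
      Function.Injective
        (fun φ : FundamentalGroup X (p e) →* G => φ.comp (FundamentalGroup.inducedMap p e))) :
    IsHomeomorph p := by
  exact hp.isHomeomorph_of_surjective_inducedMap e
    (MonoidHom.surjective_of_injective_precomp_commGroup _ hinj)
end
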